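/- arXiv:2502.05506 — 4 statements merged into one kernel-verified Lean document; each statement's English description precedes it below -/
import Mathlib

section
/- For all positive real constants c, d, k and for every positive real ℓ, the function f(n) = 1 / (d · n^(k−1) · (2^(n/(c·2^n)) − 1)) is not O(n^ℓ) as n → ∞; equivalently, f(n)/n^ℓ tends to infinity as the real variable n tends to infinity. -/
open Filter Real

theorem two_rpow_sub_one_le {x : ℝ} (hx : 0 ≤ x) (hx' : log 2 * x ≤ 1) :
    (2 : ℝ) ^ x - 1 ≤ 2 * (log 2 * x) := by
  have hlog : 0 ≤ log 2 * x := mul_nonneg (log_nonneg one_le_two) hx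
  rw [rpow_def_of_pos two_pos]
  have h := abs_exp_sub_one_le (x := log 2 * x) (by rwa [abs_of_nonneg hlog])
  rw [abs_of_nonneg hlog] at h
  exact (le_abs_self _).trans h

theorem tendsto_two_rpow_div_rpow_atTop (s : ℝ) :
    Tendsto (fun x : ℝ => (2 : ℝ) ^ x / x ^ s) atTop atTop := by
  simpa only [rpow_def_of_pos two_pos] using
    tendsto_exp_mul_div_rpow_atTop s (log 2) (log_pos one_lt_two)

/-- Theorem A.1 (abstract form): for all positive real constants `c, d, k` and every
positive real `ℓ`, the function
`f(n) = 1 / (d · n^(k−1) · (2^(n/(c·2^n)) − 1))` is not `O(n^ℓ)`; equivalently,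
`f(n)/n^ℓ → ∞` as the real variable `n → ∞`. -/
theorem stmt0 (c d k ℓ : ℝ) (hc : 0 < c) (hd : 0 < d) (hk : 0 < k) (hℓ : 0 < ℓ) :
    Tendsto
      (fun n : ℝ =>
        (1 / (d * n ^ (k - 1) * ((2 : ℝ) ^ (n / (c * (2 : ℝ) ^ n)) - 1))) / n ^ ℓ)
      atTop atTop := by
  have hlog : 0 < log 2 := log_pos one_lt_two
  refine tendsto_atTop_mono' _ ?_ ((tendsto_two_rpow_div_rpow_atTop (k + ℓ)).const_mul_atTop
    (show 0 < c / (2 * d * log 2) by positivity))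
  filter_upwards [eventually_gt_atTop 0,
    (tendsto_two_rpow_div_rpow_atTop 1).eventually_ge_atTop (log 2 / c)] with n hn hlarge
  have hpow : (0 : ℝ) < 2 ^ n := rpow_pos_of_pos two_pos n
  have hx : 0 < n / (c * 2 ^ n) := by positivity
  have hsmall : log 2 * (n / (c * 2 ^ n)) ≤ 1 := by
    rw [rpow_one, div_le_div_iff₀ hc hn] at hlarge
    rw [← mul_div_assoc, div_le_one (by positivity)]
    linarith
  have hpos : 0 < (2 : ℝ) ^ (n / (c * 2 ^ n)) - 1 :=
    sub_pos.2 (one_lt_rpow one_lt_two hx)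
  have hsplit : n ^ (k + ℓ) = n ^ (k - 1) * n * n ^ ℓ := by
    rw [rpow_add hn, ← rpow_add_one hn.ne', sub_add_cancel]
  calc c / (2 * d * log 2) * (2 ^ n / n ^ (k + ℓ))
      = 1 / (d * n ^ (k - 1) * (2 * (log 2 * (n / (c * 2 ^ n))))) / n ^ ℓ := by
        rw [hsplit]
        field_simp
    _ ≤ _ := by
        gcongr
        exact two_rpow_sub_one_le hx.le hsmall
end

section
/- Let n > 0, c > 0, d > 0, k be reals and let λ₁ > λ₂ > 0 be reals satisfying c · 2^n ≤ n / log₂(λ₁ / λ₂) and n / (λ₁ − λ₂) ≤ d · n^k. Then λ₂ ≥ 1 / (d · n^(k−1) · (2^(n/(c·2^n)) − 1)). -/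
open Real

/-- Under the exponential-separation criteria,
`λ₂ ≥ 1 / (d · n^(k−1) · (2^(n/(c·2^n)) − 1))`. -/
theorem stmt3 (n c d k lam1 lam2 : ℝ) (hn : 0 < n) (hc : 0 < c) (hd : 0 < d)
    (hlam2 : 0 < lam2) (hlt : lam2 < lam1)
    (h1 : c * (2 : ℝ) ^ n ≤ n / Real.logb 2 (lam1 / lam2))
    (h2 : n / (lam1 - lam2) ≤ d * n ^ k) :
    1 / (d * n ^ (k - 1) * ((2 : ℝ) ^ (n / (c * (2 : ℝ) ^ n)) - 1)) ≤ lam2 := by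
  have hlog : 0 < Real.logb 2 (lam1 / lam2) :=
    Real.logb_pos one_lt_two ((one_lt_div hlam2).2 hlt)
  have hden : 0 < c * (2 : ℝ) ^ n := by positivity
  have hratio : lam1 / lam2 ≤ (2 : ℝ) ^ (n / (c * (2 : ℝ) ^ n)) :=
    (Real.logb_le_iff_le_rpow one_lt_two (div_pos (hlam2.trans hlt) hlam2)).1
      ((le_div_comm₀ hden hlog).1 h1)
  have hpow : 0 < (2 : ℝ) ^ (n / (c * (2 : ℝ) ^ n)) - 1 :=
    sub_pos.2 (Real.one_lt_rpow one_lt_two (div_pos hn hden))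
  have hcoef : 0 < d * n ^ (k - 1) := by positivity
  have hgap : 1 ≤ d * n ^ (k - 1) * (lam1 - lam2) := by
    rw [div_le_iff₀ (sub_pos.2 hlt)] at h2
    have hnk : n ^ k = n ^ (k - 1) * n := by
      rw [Real.rpow_sub_one hn.ne', div_mul_cancel₀ _ hn.ne']
    rw [hnk] at h2
    refine le_of_mul_le_mul_right ?_ hn
    linarith
  rw [div_le_iff₀ hlam2] at hratio
  rw [div_le_iff₀ (mul_pos hcoef hpow)]
  calc 1 ≤ d * n ^ (k - 1) * (lam1 - lam2) := hgap
    _ ≤ d * n ^ (k - 1) * (((2 : ℝ) ^ (n / (c * (2 : ℝ) ^ n)) - 1) * lam2) :=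
        mul_le_mul_of_nonneg_left (by linarith) hcoef.le
    _ = lam2 * (d * n ^ (k - 1) * ((2 : ℝ) ^ (n / (c * (2 : ℝ) ^ n)) - 1)) := by ring
end

section
/- Let n > 0, c > 0, d > 0, k be reals and let λ₁ > λ₂ > 0 be reals satisfying c · 2^n ≤ n / log₂(λ₁ / λ₂) and n / (λ₁ − λ₂) ≤ d · n^k. Then λ₁ ≥ 1 / (d · n^(k−1) · (1 − 2^(−n/(c·2^n)))). -/
open Real

/-- Under the exponential-separation criteria,
`λ₁ ≥ 1 / (d · n^(k−1) · (1 − 2^(−n/(c·2^n))))`. -/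
theorem stmt4 (n c d k lam1 lam2 : ℝ) (hn : 0 < n) (hc : 0 < c) (hd : 0 < d)
    (hlam2 : 0 < lam2) (hlt : lam2 < lam1)
    (h1 : c * (2 : ℝ) ^ n ≤ n / Real.logb 2 (lam1 / lam2))
    (h2 : n / (lam1 - lam2) ≤ d * n ^ k) :
    1 / (d * n ^ (k - 1) * (1 - (2 : ℝ) ^ (-n / (c * (2 : ℝ) ^ n)))) ≤ lam1 := by
  have hlam1 : 0 < lam1 := hlam2.trans hlt
  have hlog : 0 < Real.logb 2 (lam1 / lam2) :=
    Real.logb_pos one_lt_two ((one_lt_div hlam2).2 hlt)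
  have hC : 0 < c * (2 : ℝ) ^ n := by positivity
  have hlog_le : Real.logb 2 (lam1 / lam2) ≤ n / (c * (2 : ℝ) ^ n) := by
    rw [le_div_iff₀ hlog] at h1
    rw [le_div_iff₀ hC]
    linarith
  have hratio : lam1 / lam2 ≤ (2 : ℝ) ^ (n / (c * (2 : ℝ) ^ n)) :=
    (Real.logb_le_iff_le_rpow one_lt_two (div_pos hlam1 hlam2)).1 hlog_le
  have hlam2_ge : lam1 * (2 : ℝ) ^ (-n / (c * (2 : ℝ) ^ n)) ≤ lam2 := by
    rw [neg_div, Real.rpow_neg zero_le_two, ← div_eq_mul_inv, div_le_iff₀ (by positivity)]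
    rw [div_le_iff₀ hlam2] at hratio
    linarith
  have hpow_le : (2 : ℝ) ^ (-n / (c * (2 : ℝ) ^ n)) ≤ 1 := by
    refine Real.rpow_le_one_of_one_le_of_nonpos one_le_two ?_
    exact div_nonpos_of_nonpos_of_nonneg (by linarith) hC.le
  have hgap : 1 ≤ d * n ^ (k - 1) * (lam1 - lam2) := by
    rw [div_le_iff₀ (sub_pos.2 hlt)] at h2
    rw [Real.rpow_sub_one hn.ne', ← mul_div_assoc, div_mul_eq_mul_div, one_le_div hn]
    exact h2
  have hD : 0 < d * n ^ (k - 1) := by positivity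
  refine div_le_of_le_mul₀ (mul_nonneg hD.le (sub_nonneg.2 hpow_le)) hlam1.le ?_
  calc 1 ≤ d * n ^ (k - 1) * (lam1 - lam2) := hgap
    _ ≤ d * n ^ (k - 1) * (lam1 - lam1 * (2 : ℝ) ^ (-n / (c * (2 : ℝ) ^ n))) := by gcongr
    _ = lam1 * (d * n ^ (k - 1) * (1 - (2 : ℝ) ^ (-n / (c * (2 : ℝ) ^ n)))) := by ring
end

section
/- Let c, d, k > 0 be reals and let λ₁, λ₂ : ℕ → ℝ be sequences such that for every natural number n ≥ 1: λ₁(n) > λ₂(n) > 0, c · 2^n ≤ n / log₂(λ₁(n) / λ₂(n)), and n / (λ₁(n) − λ₂(n)) ≤ d · n^k. Then for every real ℓ > 0, the sequence λ₁(n) / n^ℓ tends to infinity as n → ∞; in particular λ₁ is not O(n^ℓ) for any ℓ, i.e., λ₁ grows super-polynomially. -/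
open Filter Real

/-- If `n / (a - b) ≤ B` and `A ≤ n / log₂ (a / b)` with `0 < b < a`, then the larger of the two
numbers satisfies `A ≤ B * log 2 * a`. -/
theorem le_mul_of_le_div_logb_of_div_sub_le {a b A B n : ℝ} (hb : 0 < b) (hab : b < a)
    (hB : 0 ≤ B) (hA : A ≤ n / logb 2 (a / b)) (hn : n / (a - b) ≤ B) :
    A ≤ B * log 2 * a := by
  have ha : 0 < a := hb.trans hab
  have hL : 0 < logb 2 (a / b) := logb_pos one_lt_two ((one_lt_div hb).2 hab)
  have hlog : logb 2 (a / b) * log 2 = log (a / b) :=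
    div_mul_cancel₀ _ (log_pos one_lt_two).ne'
  have hsub : a - b ≤ a * log (a / b) := by
    have h := mul_le_mul_of_nonneg_left (one_sub_inv_le_log_of_pos (div_pos ha hb)) ha.le
    rwa [inv_div, mul_sub, mul_one, mul_div_cancel₀ _ ha.ne'] at h
  refine le_of_mul_le_mul_right ?_ hL
  calc A * logb 2 (a / b) ≤ n := (le_div_iff₀ hL).1 hA
    _ ≤ B * (a - b) := (div_le_iff₀ (sub_pos.2 hab)).1 hn
    _ ≤ B * (a * log (a / b)) := by gcongr
    _ = B * log 2 * a * logb 2 (a / b) := by rw [← hlog]; ring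

/-- Theorem A.1 of the paper: if for all `n ≥ 1` the exponential-separation
criteria hold (`λ₁(n) > λ₂(n) > 0`, `c·2^n ≤ n / log₂(λ₁(n)/λ₂(n))`, and
`n/(λ₁(n) − λ₂(n)) ≤ d·n^k`), then `λ₁` grows super-polynomially:
for every `ℓ > 0`, `λ₁(n)/n^ℓ → ∞`. -/
theorem stmt9 (c d k : ℝ) (hc : 0 < c) (hd : 0 < d) (hk : 0 < k)
    (lam1 lam2 : ℕ → ℝ)
    (hpos : ∀ n : ℕ, 1 ≤ n → 0 < lam2 n)
    (hlt : ∀ n : ℕ, 1 ≤ n → lam2 n < lam1 n)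
    (h1 : ∀ n : ℕ, 1 ≤ n →
      c * (2 : ℝ) ^ (n : ℝ) ≤ (n : ℝ) / Real.logb 2 (lam1 n / lam2 n))
    (h2 : ∀ n : ℕ, 1 ≤ n →
      (n : ℝ) / (lam1 n - lam2 n) ≤ d * (n : ℝ) ^ k) :
    ∀ ℓ : ℝ, 0 < ℓ →
      Tendsto (fun n : ℕ => lam1 n / (n : ℝ) ^ ℓ) atTop atTop := by
  intro ℓ _
  have hlog2 : 0 < log 2 := log_pos one_lt_two
  have hgrow : Tendsto (fun n : ℕ => c / (d * log 2) *
      (exp (log 2 * (n : ℝ)) / (n : ℝ) ^ (k + ℓ))) atTop atTop :=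
    ((tendsto_exp_mul_div_rpow_atTop (k + ℓ) (log 2) hlog2).comp
      tendsto_natCast_atTop_atTop).const_mul_atTop (by positivity)
  refine tendsto_atTop_mono' _ ?_ hgrow
  filter_upwards [eventually_ge_atTop 1] with n hn
  have hn0 : (0 : ℝ) < n := by exact_mod_cast hn
  have hkey := le_mul_of_le_div_logb_of_div_sub_le (hpos n hn) (hlt n hn) (by positivity)
    (h1 n hn) (h2 n hn)
  rw [rpow_def_of_pos two_pos] at hkey
  rw [rpow_add hn0, div_mul_div_comm, div_le_div_iff₀ (by positivity) (by positivity)]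
  calc c * exp (log 2 * n) * (n : ℝ) ^ ℓ
      ≤ d * (n : ℝ) ^ k * log 2 * lam1 n * (n : ℝ) ^ ℓ := by gcongr
    _ = lam1 n * (d * log 2 * ((n : ℝ) ^ k * (n : ℝ) ^ ℓ)) := by ring
end
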